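/- arXiv:1910.07935 — 3 statements merged into one kernel-verified Lean document; each statement's English description precedes it below -/
import Mathlib

section
/- Let d_A, d_B ∈ ℝ² be linearly independent unit vectors and let α ∈ (0, π) be the angle between them (so sin α > 0). Let 0 < S ≤ L and let s, t : ℤ → ℝ be strictly increasing sequences all of whose consecutive differences s(m+1) − s(m) and t(k+1) − t(k) lie in {S, L}. Let V = { s(m)·d_A + t(k)·d_B : m, k ∈ ℤ } be the vertex set of the bigrid (the intersection points of the line family { s(m)·d_A + ℝ·d_B : m ∈ ℤ } with the family { t(k)·d_B + ℝ·d_A : k ∈ ℤ }). Then V is a Delone set with explicit constants: (i) any two distinct points of V are at Euclidean distance at least S·sin α (uniform discreteness), and (ii) every closed ball in ℝ² of radius L contains at least one point of V (relative density). -/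
theorem bigrid_aux_mono (S L : ℝ) (hSL : S ≤ L) (s : ℤ → ℝ)
    (hsd : ∀ m : ℤ, s (m + 1) - s m = S ∨ s (m + 1) - s m = L) :
    Monotone (fun n : ℤ => s n - n * S) := by
  apply monotone_int_of_le_succ
  intro n
  push_cast
  rcases hsd n with h | h <;> linarith

theorem bigrid_aux_sep (S L : ℝ) (hS : 0 < S) (hSL : S ≤ L) (s : ℤ → ℝ)
    (hsd : ∀ m : ℤ, s (m + 1) - s m = S ∨ s (m + 1) - s m = L) (m n : ℤ) (hmn : m ≠ n) :
    S ^ 2 ≤ (s m - s n) ^ 2 := by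
  have key : ∀ a b : ℤ, a < b → S ≤ s b - s a := by
    intro a b hab
    have h := bigrid_aux_mono S L hSL s hsd hab.le
    have h1 : (a : ℝ) + 1 ≤ b := by exact_mod_cast hab
    simp only at h
    nlinarith
  rcases lt_or_gt_of_ne hmn with h | h
  · have := key _ _ h
    nlinarith
  · have := key _ _ h
    nlinarith

theorem bigrid_aux_near (S L : ℝ) (hS : 0 < S) (hSL : S ≤ L) (s : ℤ → ℝ)
    (hsd : ∀ m : ℤ, s (m + 1) - s m = S ∨ s (m + 1) - s m = L) (a : ℝ) :
    ∃ m : ℤ, |s m - a| ≤ L / 2 := by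
  have hm := bigrid_aux_mono S L hSL s hsd
  have h1 : ∃ b : ℤ, ∀ z : ℤ, s z ≤ a → z ≤ b := by
    obtain ⟨N, hN⟩ := exists_nat_gt ((a - s 0) / S)
    rw [div_lt_iff₀ hS] at hN
    refine ⟨N, fun z hz => ?_⟩
    by_contra! hc
    have h0 : (0 : ℤ) ≤ z := by omega
    have h2 := hm h0
    have h3 : (N : ℝ) < z := by exact_mod_cast hc
    simp only [Int.cast_zero] at h2
    nlinarith
  have h2 : ∃ z : ℤ, s z ≤ a := by
    obtain ⟨N, hN⟩ := exists_nat_gt ((s 0 - a) / S)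
    rw [div_lt_iff₀ hS] at hN
    refine ⟨-N, ?_⟩
    have h0 : (-N : ℤ) ≤ 0 := by omega
    have h2 := hm h0
    simp only [Int.cast_zero, Int.cast_neg, Int.cast_natCast] at h2
    nlinarith
  obtain ⟨m, hma, hmax⟩ := Int.exists_greatest_of_bdd h1 h2
  have h3 : a < s (m + 1) := by
    by_contra! hc
    have := hmax _ hc
    omega
  have h4 : s (m + 1) - s m ≤ L := by rcases hsd m with h | h <;> linarith
  by_cases h5 : a - s m ≤ L / 2
  · exact ⟨m, by rw [abs_le]; constructor <;> linarith⟩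
  · exact ⟨m + 1, by rw [abs_le]; constructor <;> linarith⟩

/-- The vertex set of a bigrid built from two families of parallel lines with
directions `dA`, `dB` (unit vectors at angle `α ∈ (0, π)`), with interline
spacings in `{S, L}`, is a Delone set: distinct vertices are at distance at
least `S·sin α`, and every closed ball of radius `L` contains a vertex. -/
theorem bigrid_vertex_set_is_delone
    (dA dB : EuclideanSpace ℝ (Fin 2))
    (hdA : ‖dA‖ = 1) (hdB : ‖dB‖ = 1)
    (hind : LinearIndependent ℝ ![dA, dB])
    (α : ℝ) (hα : α ∈ Set.Ioo 0 Real.pi)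
    (hangle : InnerProductGeometry.angle dA dB = α)
    (S L : ℝ) (hS : 0 < S) (hSL : S ≤ L)
    (s t : ℤ → ℝ) (hs : StrictMono s) (ht : StrictMono t)
    (hsd : ∀ m : ℤ, s (m + 1) - s m = S ∨ s (m + 1) - s m = L)
    (htd : ∀ k : ℤ, t (k + 1) - t k = S ∨ t (k + 1) - t k = L)
    (V : Set (EuclideanSpace ℝ (Fin 2)))
    (hV : V = {v | ∃ m k : ℤ, v = s m • dA + t k • dB}) :
    (∀ x ∈ V, ∀ y ∈ V, x ≠ y → S * Real.sin α ≤ dist x y) ∧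
    (∀ c : EuclideanSpace ℝ (Fin 2), ∃ v ∈ V, v ∈ Metric.closedBall c L) := by
  subst hV
  constructor
  · rintro x ⟨m, k, rfl⟩ y ⟨m', k', rfl⟩ hne
    have hin : inner ℝ dA dB = Real.cos α := by
      rw [← hangle, InnerProductGeometry.cos_angle, hdA, hdB]; simp
    have hsin : 0 < Real.sin α := Real.sin_pos_of_mem_Ioo hα
    have hsc := Real.sin_sq_add_cos_sq α
    rw [dist_eq_norm]
    have e : s m • dA + t k • dB - (s m' • dA + t k' • dB)
        = (s m - s m') • dA + (t k - t k') • dB := by module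
    rw [e]
    refine (abs_le_of_sq_le_sq' ?_ (norm_nonneg _)).2
    have hn : ‖(s m - s m') • dA + (t k - t k') • dB‖ ^ 2
        = (s m - s m') ^ 2 + 2 * ((s m - s m') * (t k - t k') * Real.cos α)
          + (t k - t k') ^ 2 := by
      rw [norm_add_sq_real, norm_smul, norm_smul, hdA, hdB, inner_smul_left, inner_smul_right, hin]
      simp
      ring
    rw [hn, mul_pow]
    have hor : m ≠ m' ∨ k ≠ k' := by
      by_contra! hc
      exact hne (by rw [hc.1, hc.2])
    set p := s m - s m' with hp
    set q := t k - t k' with hq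
    rcases hor with h | h
    · have h1 : S ^ 2 ≤ p ^ 2 := bigrid_aux_sep S L hS hSL s hsd m m' h
      have h2 := mul_le_mul_of_nonneg_right h1 (sq_nonneg (Real.sin α))
      have h3 : p ^ 2 + 2 * (p * q * Real.cos α) + q ^ 2
        = p ^ 2 * Real.sin α ^ 2 + (q + p * Real.cos α) ^ 2 := by
        linear_combination (-p ^ 2) * hsc
      nlinarith [sq_nonneg (q + p * Real.cos α)]
    · have h1 : S ^ 2 ≤ q ^ 2 := bigrid_aux_sep S L hS hSL t htd k k' h
      have h2 := mul_le_mul_of_nonneg_right h1 (sq_nonneg (Real.sin α))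
      have h3 : p ^ 2 + 2 * (p * q * Real.cos α) + q ^ 2
        = q ^ 2 * Real.sin α ^ 2 + (p + q * Real.cos α) ^ 2 := by
        linear_combination (-q ^ 2) * hsc
      nlinarith [sq_nonneg (p + q * Real.cos α)]
  · intro c
    have hspan : Submodule.span ℝ (Set.range ![dA, dB]) = ⊤ :=
      hind.span_eq_top_of_card_eq_finrank (by simp)
    have hc : c ∈ Submodule.span ℝ {dA, dB} := by
      have : c ∈ Submodule.span ℝ (Set.range ![dA, dB]) := by rw [hspan]; trivial
      simpa [Matrix.range_cons, Matrix.range_empty, Set.pair_comm] using this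
    obtain ⟨a, b, rfl⟩ := Submodule.mem_span_pair.mp hc
    obtain ⟨m, hm⟩ := bigrid_aux_near S L hS hSL s hsd a
    obtain ⟨k, hk⟩ := bigrid_aux_near S L hS hSL t htd b
    refine ⟨_, ⟨m, k, rfl⟩, ?_⟩
    rw [Metric.mem_closedBall, dist_eq_norm]
    have e : s m • dA + t k • dB - (a • dA + b • dB)
        = (s m - a) • dA + (t k - b) • dB := by module
    rw [e]
    refine (norm_add_le _ _).trans ?_
    rw [norm_smul, norm_smul, hdA, hdB, Real.norm_eq_abs, Real.norm_eq_abs]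
    linarith
end

section
/- Let d_A, d_B ∈ ℝ² be linearly independent unit vectors, let 0 < S < L, and let w : ℤ → ℝ be a balanced sequence taking values in {S, L}, i.e., for all i, j ∈ ℤ and k ∈ ℕ the numbers of occurrences of S in the windows w(i), …, w(i+k−1) and w(j), …, w(j+k−1) differ by at most 1. Fix i, j ∈ ℤ and define the osculating path p : ℕ → ℝ² by p(2k) = (Σ_{t<k} w(i+t))·d_A + (Σ_{t<k} w(j+t))·d_B and p(2k+1) = p(2k) + w(i+k)·d_A. Then every point of the path lies within distance 2L − S of the line ℝ·(d_A + d_B) through the origin in the direction of the angle bisector of d_A and d_B; i.e., for all n, dist(p(n), ℝ·(d_A + d_B)) ≤ 2L − S. In particular the path is well-behaved. -/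
open Classical in
/-- In a bigrid whose spacings are given by a balanced word `w`, each osculating
path (alternating steps in directions `dA` and `dB`, with step lengths given by
two windows of `w` at offsets `i` and `j`) stays within distance `2L - S` of the
bisector line `ℝ·(dA + dB)`; i.e. the path is well-behaved. -/
theorem sturmian_osculating_path_well_behaved
    (dA dB : EuclideanSpace ℝ (Fin 2))
    (hdA : ‖dA‖ = 1) (hdB : ‖dB‖ = 1)
    (hind : LinearIndependent ℝ ![dA, dB])
    (S L : ℝ) (hS : 0 < S) (hSL : S < L)
    (w : ℤ → ℝ) (hw : ∀ i : ℤ, w i = S ∨ w i = L)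
    (hbal : ∀ i j : ℤ, ∀ k : ℕ,
      |((((Finset.range k).filter fun t => w (i + t) = S).card : ℤ) -
        (((Finset.range k).filter fun t => w (j + t) = S).card : ℤ))| ≤ 1)
    (i j : ℤ) (p : ℕ → EuclideanSpace ℝ (Fin 2))
    (hp0 : ∀ k : ℕ, p (2 * k) =
      (∑ t ∈ Finset.range k, w (i + t)) • dA + (∑ t ∈ Finset.range k, w (j + t)) • dB)
    (hp1 : ∀ k : ℕ, p (2 * k + 1) = p (2 * k) + w (i + k) • dA) :
    ∀ n : ℕ,
      Metric.infDist (p n) (Set.range fun r : ℝ => r • (dA + dB)) ≤ 2 * L - S := by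
  have hcast : ∀ (a : ℤ) (k : ℕ), ((Finset.range k).filter fun t => w (a + t) = S).card =
      ((Finset.range k).filter fun t : ℕ => w (a + t) = S).card := by
    intro a k
    symm
    apply Finset.card_bij (fun (t : ℕ) _ => (t : ℤ))
    · intro t ht
      simpa using ht
    · intro t _ u _ htu
      exact_mod_cast htu
    · intro z hz
      simp at hz
      obtain ⟨⟨t, ht, rfl⟩, h⟩ := hz
      exact ⟨t, by simp [ht, h], rfl⟩
  have hsum : ∀ (a : ℤ) (k : ℕ), ∑ t ∈ Finset.range k, w (a + t) =
      k * L - (L - S) * (((Finset.range k).filter fun t : ℕ => w (a + t) = S).card : ℝ) := by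
    intro a k
    induction k with
    | zero => simp
    | succ k ih =>
      rw [Finset.sum_range_succ, ih, Finset.range_add_one, Finset.filter_insert]
      rcases hw (a + k) with h | h
      · rw [if_pos h, Finset.card_insert_of_notMem (by simp), h]
        push_cast
        ring
      · have h' : ¬ w (a + k) = S := by rw [h]; exact hSL.ne'
        rw [if_neg h', h]
        push_cast
        ring
  have hdiff : ∀ k : ℕ, |∑ t ∈ Finset.range k, w (i + t) - ∑ t ∈ Finset.range k, w (j + t)|
      ≤ L - S := by
    intro k
    have h := hbal i j k
    rw [hcast i k, hcast j k] at h
    have h2 : |((((Finset.range k).filter fun t : ℕ => w (i + t) = S).card : ℝ) -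
        (((Finset.range k).filter fun t : ℕ => w (j + t) = S).card : ℝ))| ≤ 1 := by
      exact_mod_cast h
    rw [hsum i k, hsum j k]
    rw [abs_le] at h2 ⊢
    constructor <;> nlinarith [h2.1, h2.2]
  have key : ∀ x y : ℝ, |x - y| ≤ 2 * L - S →
      Metric.infDist (x • dA + y • dB) (Set.range fun r : ℝ => r • (dA + dB)) ≤ 2 * L - S := by
    intro x y hxy
    refine (Metric.infDist_le_dist_of_mem (Set.mem_range_self y)).trans ?_
    have e : x • dA + y • dB - y • (dA + dB) = (x - y) • dA := by module
    rw [dist_eq_norm, e, norm_smul, hdA, mul_one]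
    exact hxy
  intro n
  obtain ⟨k, hk | hk⟩ := Nat.even_or_odd' n
  · rw [hk, hp0]
    exact key _ _ ((hdiff k).trans (by linarith))
  · rw [hk, hp1, hp0, add_right_comm, ← add_smul]
    apply key
    have h := abs_le.1 (hdiff k)
    rw [abs_le]
    rcases hw (i + k) with h' | h' <;> rw [h'] <;> constructor <;> linarith [h.1, h.2]
end

section
/- Let d_A, d_B ∈ ℝ² be linearly independent unit vectors and let 0 < S < L. Then there exist sequences a, b : ℕ → ℝ taking values in {S, L} such that the alternating path p : ℕ → ℝ² defined by p(2k) = (Σ_{t<k} a(t))·d_A + (Σ_{t<k} b(t))·d_B and p(2k+1) = p(2k) + a(k)·d_A is not well-behaved: for every affine line ℓ in ℝ² and every real s > 0 there exists n ∈ ℕ with dist(p(n), ℓ) > s. -/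
/-- block letter sequence -/
noncomputable def blk (S L : ℝ) (k : ℕ) : ℝ := if Even (Nat.log 2 k) then S else L

lemma blk_sum (S L : ℝ) (j : ℕ) :
    ∑ t ∈ Finset.range (2 ^ (j + 1)), blk S L t =
      ∑ t ∈ Finset.range (2 ^ j), blk S L t + 2 ^ j * (if Even j then S else L) := by
  have h := Finset.sum_Ico_eq_sub (blk S L)
    (Nat.pow_le_pow_right (by norm_num : 0 < 2) (Nat.le_succ j))
  have h2 : ∑ t ∈ Finset.Ico (2 ^ j) (2 ^ (j + 1)), blk S L t =
      2 ^ j * (if Even j then S else L) := by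
    have : ∀ t ∈ Finset.Ico (2 ^ j) (2 ^ (j + 1)), blk S L t = (if Even j then S else L) := by
      intro t ht
      rw [Finset.mem_Ico] at ht
      have : Nat.log 2 t = j := Nat.log_eq_of_pow_le_of_lt_pow ht.1 ht.2
      simp only [blk, this]
    rw [Finset.sum_congr rfl this, Finset.sum_const, Nat.card_Ico, nsmul_eq_mul]
    have : 2 ^ (j + 1) - 2 ^ j = 2 ^ j := by rw [pow_succ]; omega
    rw [this]; push_cast; ring
  simp only [Nat.succ_eq_add_one] at h
  linarith

lemma zero_of_bdd (c C : ℝ) (f : ℕ → ℕ) (hf : ∀ n, n ≤ f n) (h : ∀ n, |2 ^ (f n) * c| ≤ C) :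
    c = 0 := by
  by_contra hc
  have hc' : 0 < |c| := abs_pos.mpr hc
  obtain ⟨n, hn⟩ := pow_unbounded_of_one_lt (C / |c|) (by norm_num : (1 : ℝ) < 2)
  have h1 := h n
  rw [abs_mul, abs_of_pos (by positivity : (0 : ℝ) < 2 ^ f n)] at h1
  have h2 : (2 : ℝ) ^ n ≤ 2 ^ f n := pow_le_pow_right₀ (by norm_num) (hf n)
  rw [div_lt_iff₀ hc'] at hn
  nlinarith

/-- There exist `{S, L}`-valued spacing sequences `a`, `b` whose alternating bigrid
path is not well-behaved: the path deviates beyond every bound `s` from every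
affine line in the plane. -/
theorem exists_not_well_behaved_osculating_path
    (dA dB : EuclideanSpace ℝ (Fin 2))
    (hdA : ‖dA‖ = 1) (hdB : ‖dB‖ = 1)
    (hind : LinearIndependent ℝ ![dA, dB])
    (S L : ℝ) (hS : 0 < S) (hSL : S < L) :
    ∃ a b : ℕ → ℝ,
      (∀ k : ℕ, a k = S ∨ a k = L) ∧ (∀ k : ℕ, b k = S ∨ b k = L) ∧
      ∀ p : ℕ → EuclideanSpace ℝ (Fin 2),
        (∀ k : ℕ, p (2 * k) =
          (∑ t ∈ Finset.range k, a t) • dA + (∑ t ∈ Finset.range k, b t) • dB) →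
        (∀ k : ℕ, p (2 * k + 1) = p (2 * k) + a k • dA) →
        ∀ x v : EuclideanSpace ℝ (Fin 2), v ≠ 0 → ∀ s : ℝ, 0 < s →
          ∃ n : ℕ, s < Metric.infDist (p n) (Set.range fun r : ℝ => x + r • v) := by
  refine ⟨blk S L, fun _ => S, fun k => ?_, fun k => Or.inl rfl, ?_⟩
  · unfold blk; split_ifs <;> simp
  intro p hp _ x v hv s hs
  by_contra! hcon
  set φ : EuclideanSpace ℝ (Fin 2) → ℝ := fun y => v 0 * y 1 - v 1 * y 0 with hφ
  set K : ℝ := |v 0| + |v 1| with hK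
  have hb : ∀ n, |φ (p n) - φ x| ≤ K * (s + 1) := by
    intro n
    have hlt : Metric.infDist (p n) (Set.range fun r : ℝ => x + r • v) < s + 1 := by
      linarith [hcon n]
    obtain ⟨y, ⟨r, rfl⟩, hy⟩ := (Metric.infDist_lt_iff (Set.range_nonempty _)).1 hlt
    rw [dist_eq_norm] at hy
    have h0 := PiLp.norm_apply_le (p n - (x + r • v)) 0
    have h1 := PiLp.norm_apply_le (p n - (x + r • v)) 1
    rw [Real.norm_eq_abs] at h0 h1
    have e : φ (p n) - φ x = v 0 * (p n - (x + r • v)) 1 - v 1 * (p n - (x + r • v)) 0 := by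
      simp [hφ]; ring
    rw [e]
    refine (abs_sub _ _).trans ?_
    rw [abs_mul, abs_mul, hK, add_mul]
    gcongr
    · linarith
    · linarith
  set D : ℝ := K * (s + 1)
  have hφp : ∀ k, φ (p (2 * k)) = (∑ t ∈ Finset.range k, blk S L t) * φ dA + k * S * φ dB := by
    intro k
    rw [hp k]
    simp [hφ]; ring
  have hd : ∀ j : ℕ, |2 ^ j * ((if Even j then S else L) * φ dA + S * φ dB)| ≤ 2 * D := by
    intro j
    have e : 2 ^ j * ((if Even j then S else L) * φ dA + S * φ dB) =
        (φ (p (2 * 2 ^ (j + 1))) - φ x) - (φ (p (2 * 2 ^ j)) - φ x) := by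
      rw [hφp, hφp, blk_sum]; push_cast; ring
    rw [e]
    refine (abs_sub _ _).trans ?_
    linarith [hb (2 * 2 ^ (j + 1)), hb (2 * 2 ^ j)]
  have z1 : S * φ dA + S * φ dB = 0 := by
    refine zero_of_bdd _ (2 * D) (fun n => 2 * n) (fun n => by omega) fun n => ?_
    simpa using hd (2 * n)
  have z2 : L * φ dA + S * φ dB = 0 := by
    refine zero_of_bdd _ (2 * D) (fun n => 2 * n + 1) (fun n => by omega) fun n => ?_
    have := hd (2 * n + 1)
    rwa [if_neg (by simp)] at this
  have hA : φ dA = 0 := by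
    have : (L - S) * φ dA = 0 := by linarith
    exact (mul_eq_zero.1 this).resolve_left (by linarith)
  have hB : φ dB = 0 := by
    rw [hA] at z1
    exact (mul_eq_zero.1 (by linarith : S * φ dB = 0)).resolve_left hS.ne'
  simp only [hφ] at hA hB
  have hdet : dA 0 * dB 1 - dA 1 * dB 0 = 0 := by
    have e0 : v 0 * (dA 0 * dB 1 - dA 1 * dB 0) = 0 := by linear_combination dA 0 * hB - dB 0 * hA
    have e1 : v 1 * (dA 0 * dB 1 - dA 1 * dB 0) = 0 := by linear_combination dA 1 * hB - dB 1 * hA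
    by_contra hne
    apply hv
    ext i
    fin_cases i
    · exact (mul_eq_zero.1 e0).resolve_right hne
    · exact (mul_eq_zero.1 e1).resolve_right hne
  rw [LinearIndependent.pair_iff] at hind
  have i1 := hind (dB 1) (-dA 1) (by
    ext i
    fin_cases i
    · simp; linarith
    · simp; ring)
  have i0 := hind (dB 0) (-dA 0) (by
    ext i
    fin_cases i
    · simp; ring
    · simp; linarith)
  have : dA = 0 := by
    ext i
    fin_cases i
    · simpa using i0.2
    · simpa using i1.2
  rw [this] at hdA
  simp at hdA
end
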